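/- Let A and B be finite sets with |A| ≥ |B| ≥ 1, and for i = 1, …, m let R_i^A be a k_i-ary relation on A all of whose tuples have pairwise distinct entries, and let R_i^B be a k_i-ary relation on B. Let k_max = max_i k_i. Then there exists a surjective function h : A → B with Val(h) ≥ (1 − k_max·|B|/|A|) · (min_i |R_i^B|/|B|^{k_i}) · Σ_{i=1}^{m} |R_i^A|. -/

import Mathlib

/-- `Val RA RB h` : the total number of tuples, over all relations `RA i`,
satisfied by the assignment `h` (a tuple `t ∈ RA i` is satisfied if `h ∘ t ∈ RB i`). -/
def Val {A B : Type} [DecidableEq B] {m : ℕ} {k : Fin m → ℕ}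
    (RA : ∀ i, Finset (Fin (k i) → A)) (RB : ∀ i, Finset (Fin (k i) → B))
    (h : A → B) : ℕ :=
  ∑ i, ((RA i).filter (fun t => (h ∘ t) ∈ RB i)).card

/-- For an injective tuple `t`, a uniformly random `g : A → B` restricts along `t` to a uniformly
random tuple. -/
theorem card_filter_comp_mem_mul {ι A B : Type} [Fintype ι] [Fintype A] [DecidableEq A]
    [Fintype B] [DecidableEq B] [DecidableEq ι] {t : ι → A} (ht : Function.Injective t)
    (R : Finset (ι → B)) :
    (Finset.univ.filter (fun g : A → B => g ∘ t ∈ R)).card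
        * Fintype.card B ^ Fintype.card ι
      = R.card * Fintype.card B ^ Fintype.card A := by
  classical
  let C := {a : A // a ∉ Set.range t}
  let e : ι ⊕ C ≃ A :=
    ((Equiv.ofInjective t ht).sumCongr (Equiv.refl C)).trans (Equiv.Set.sumCompl (Set.range t))
  let E : (A → B) ≃ (ι → B) × (C → B) :=
    (e.symm.arrowCongr (Equiv.refl B)).trans (Equiv.sumArrowEquivProdArrow ι C B)
  have hE : ∀ g : A → B, (E g).1 = g ∘ t := fun g => rfl
  have hcard : (Finset.univ.filter (fun g : A → B => g ∘ t ∈ R)).card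
      = (R ×ˢ (Finset.univ : Finset (C → B))).card :=
    Finset.card_equiv E fun g => by simp [hE]
  have hA : Fintype.card A = Fintype.card ι + Fintype.card C := by
    rw [← Fintype.card_congr e, Fintype.card_sum]
  rw [hcard, Finset.card_product, Finset.card_univ, Fintype.card_fun, hA]
  ring

/-- A transitive family of injections `B → A`, indexed by `A`: the translates of a fixed injection
for a cyclic group structure on `A`. -/
theorem exists_injections_bijective_eval {A B : Type} [Fintype A] [Fintype B] [Nonempty A]
    (hBA : Fintype.card B ≤ Fintype.card A) :
    ∃ e : A → B → A, (∀ c, Function.Injective (e c)) ∧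
      ∀ b, Function.Injective (fun c => e c b) := by
  have : NeZero (Fintype.card A) := ⟨Fintype.card_ne_zero⟩
  obtain ⟨f⟩ := Function.Embedding.nonempty_of_card_le hBA
  let φ : A ≃ Fin (Fintype.card A) := Fintype.equivFin A
  refine ⟨fun c b => φ.symm (φ c + φ (f b)), fun c x y h => ?_, fun b x y h => ?_⟩
  · simpa using h
  · simpa using h

/-- All but `|ι| * |B|` members of a transitive family of injections have range disjoint from a
given tuple. -/
theorem card_le_card_filter_disjoint_add {ι A B : Type} [Fintype ι] [Fintype A] [DecidableEq A]
    [Fintype B] (e : A → B → A) (he : ∀ b, Function.Injective (fun c => e c b)) (t : ι → A)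
    [DecidablePred fun c => ∀ j b, e c b ≠ t j] :
    Fintype.card A ≤ (Finset.univ.filter (fun c => ∀ j b, e c b ≠ t j)).card
      + Fintype.card ι * Fintype.card B := by
  classical
  rw [← Finset.card_univ, ← Finset.card_filter_add_card_filter_not (fun c => ∀ j b, e c b ≠ t j)]
  gcongr
  have hsub : (Finset.univ.filter (fun c => ¬ ∀ j b, e c b ≠ t j))
      ⊆ (Finset.univ : Finset (ι × B)).biUnion
        (fun p => Finset.univ.filter (fun c => e c p.2 = t p.1)) := by
    intro c hc
    simpa using hc
  calc _ ≤ _ := Finset.card_le_card hsub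
    _ ≤ (Finset.univ : Finset (ι × B)).card * 1 :=
        Finset.card_biUnion_le_card_mul _ _ _ fun p _ => Finset.card_le_one.2 fun x hx y hy =>
          he p.2 <| (Finset.mem_filter.1 hx).2.trans (Finset.mem_filter.1 hy).2.symm
    _ = _ := by simp

/-- The function that inverts `e` on its range and agrees with `g` elsewhere. -/
noncomputable def overrideInv {A B : Type} (e : B → A) (g : A → B) : A → B :=
  Function.extend e id g

theorem overrideInv_surjective {A B : Type} {e : B → A} (he : Function.Injective e) (g : A → B) :
    Function.Surjective (overrideInv e g) :=
  fun b => ⟨e b, he.extend_apply id g b⟩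

theorem card_filter_overrideInv_ge {A B : Type} [Fintype A] [DecidableEq A] [Fintype B]
    [DecidableEq B] [Nonempty A] [Nonempty B] (e : A → B → A)
    (he : ∀ b, Function.Injective (fun c => e c b)) {n : ℕ} {t : Fin n → A}
    (ht : Function.Injective t) (R : Finset (Fin n → B)) :
    (1 - n * (Fintype.card B : ℚ) / Fintype.card A) * (R.card / (Fintype.card B : ℚ) ^ n)
        * (Fintype.card (A × (A → B)) : ℚ)
      ≤ (Finset.univ.filter
          (fun p : A × (A → B) => overrideInv (e p.1) p.2 ∘ t ∈ R)).card := by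
  have hsub : (Finset.univ.filter (fun c => ∀ j b, e c b ≠ t j))
      ×ˢ (Finset.univ.filter (fun g : A → B => g ∘ t ∈ R))
      ⊆ Finset.univ.filter (fun p : A × (A → B) => overrideInv (e p.1) p.2 ∘ t ∈ R) := by
    rintro ⟨c, g⟩ hp
    simp only [Finset.mem_product, Finset.mem_filter, Finset.mem_univ, true_and] at hp ⊢
    have : overrideInv (e c) g ∘ t = g ∘ t := funext fun j =>
      Function.extend_apply' _ _ _ fun ⟨b, hb⟩ => hp.1 j b hb
    rw [this]
    exact hp.2
  have h₁ := Finset.card_le_card hsub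
  rw [Finset.card_product] at h₁
  have h₂ := card_le_card_filter_disjoint_add e he t
  have h₃ := card_filter_comp_mem_mul ht R
  rw [Fintype.card_fin] at h₂ h₃
  rw [Fintype.card_prod, Fintype.card_fun]
  have hA : (0 : ℚ) < Fintype.card A := by exact_mod_cast Fintype.card_pos
  have hB : (0 : ℚ) < (Fintype.card B : ℚ) ^ n := by
    have : (0 : ℚ) < Fintype.card B := by exact_mod_cast Fintype.card_pos
    positivity
  refine le_trans ?_ (Nat.cast_le.2 h₁)
  generalize (Finset.univ.filter (fun c => ∀ j b, e c b ≠ t j)).card = x at *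
  generalize (Finset.univ.filter (fun g : A → B => g ∘ t ∈ R)).card = y at *
  have h₂' : (Fintype.card A : ℚ) - n * Fintype.card B ≤ x := by
    rw [sub_le_iff_le_add]
    exact_mod_cast h₂
  have h₃' : (y : ℚ) = R.card * (Fintype.card B : ℚ) ^ Fintype.card A
      / (Fintype.card B : ℚ) ^ n := by
    rw [eq_div_iff hB.ne']
    exact_mod_cast h₃
  calc _ = ((Fintype.card A : ℚ) - n * Fintype.card B) * y := by
        rw [h₃']
        push_cast
        field_simp
    _ ≤ x * y := by gcongr
    _ = _ := by push_cast; rfl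

theorem sum_val_eq {A B Ω : Type} [Fintype Ω] [DecidableEq B] {m : ℕ} {k : Fin m → ℕ}
    (RA : ∀ i, Finset (Fin (k i) → A)) (RB : ∀ i, Finset (Fin (k i) → B)) (h : Ω → A → B) :
    ∑ ω, Val RA RB (h ω)
      = ∑ i, ∑ t ∈ RA i, (Finset.univ.filter (fun ω => h ω ∘ t ∈ RB i)).card := by
  simp only [Val, Finset.card_filter]
  rw [Finset.sum_comm]
  exact Finset.sum_congr rfl fun i _ => Finset.sum_comm

/-- If every tuple is satisfied by at least a fraction `q` of a family of functions, then some
member of the family satisfies at least a fraction `q` of all tuples. -/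
theorem exists_mul_sum_card_le_val {A B Ω : Type} [Fintype Ω] [Nonempty Ω] [DecidableEq B]
    {m : ℕ} {k : Fin m → ℕ} (RA : ∀ i, Finset (Fin (k i) → A))
    (RB : ∀ i, Finset (Fin (k i) → B)) (h : Ω → A → B) (q : ℚ)
    (hq : ∀ i, ∀ t ∈ RA i,
      q * Fintype.card Ω ≤ (Finset.univ.filter (fun ω => h ω ∘ t ∈ RB i)).card) :
    ∃ ω, q * ∑ i, ((RA i).card : ℚ) ≤ Val RA RB (h ω) := by
  have hsum : ∑ _ω : Ω, q * ∑ i, ((RA i).card : ℚ) ≤ ∑ ω, (Val RA RB (h ω) : ℚ) := by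
    rw [← Nat.cast_sum Finset.univ (fun ω => Val RA RB (h ω)), sum_val_eq]
    push_cast
    rw [Finset.sum_const, Finset.card_univ, nsmul_eq_mul, Finset.mul_sum, Finset.mul_sum]
    refine Finset.sum_le_sum fun i _ => ?_
    calc _ = ∑ _t ∈ RA i, q * (Fintype.card Ω : ℚ) := by
          rw [Finset.sum_const, nsmul_eq_mul]
          ring
      _ ≤ _ := Finset.sum_le_sum fun t ht => hq i t ht
  obtain ⟨ω, -, hω⟩ := Finset.exists_le_of_sum_le Finset.univ_nonempty hsum
  exact ⟨ω, hω⟩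

theorem stmt_6 {A B : Type} [Fintype A] [DecidableEq A] [Fintype B] [DecidableEq B]
    (hBA : Fintype.card B ≤ Fintype.card A) (hB : 1 ≤ Fintype.card B)
    (m : ℕ) (hm : 0 < m) (k : Fin m → ℕ)
    (RA : ∀ i, Finset (Fin (k i) → A)) (RB : ∀ i, Finset (Fin (k i) → B))
    (hdist : ∀ i, ∀ t ∈ RA i, Function.Injective t)
    (kmax : ℕ) (hkmax : kmax = Finset.univ.sup' ⟨⟨0, hm⟩, Finset.mem_univ _⟩ k) :
    ∃ h : A → B, Function.Surjective h ∧
      (Val RA RB h : ℚ)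
        ≥ (1 - kmax * (Fintype.card B : ℚ) / (Fintype.card A : ℚ))
          * (Finset.univ.inf' ⟨⟨0, hm⟩, Finset.mem_univ _⟩
              (fun i => ((RB i).card : ℚ) / (Fintype.card B : ℚ) ^ (k i)))
          * ∑ i, ((RA i).card : ℚ) := by
  have : Nonempty B := Fintype.card_pos_iff.1 hB
  have : Nonempty A := Fintype.card_pos_iff.1 (hB.trans hBA)
  obtain ⟨e, he, he'⟩ := exists_injections_bijective_eval hBA
  set μ := Finset.univ.inf' ⟨⟨0, hm⟩, Finset.mem_univ _⟩
    (fun i => ((RB i).card : ℚ) / (Fintype.card B : ℚ) ^ (k i))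
  have hμ₀ : 0 ≤ μ := Finset.le_inf' _ _ fun i _ => by positivity
  have hμi : ∀ i, μ ≤ ((RB i).card : ℚ) / (Fintype.card B : ℚ) ^ (k i) :=
    fun i => Finset.inf'_le _ (Finset.mem_univ i)
  have hki : ∀ i, k i ≤ kmax := fun i => hkmax ▸ Finset.le_sup' k (Finset.mem_univ i)
  set δ : ℚ := 1 - kmax * (Fintype.card B : ℚ) / (Fintype.card A : ℚ) with hδ
  have hδi : ∀ i, δ ≤ 1 - k i * (Fintype.card B : ℚ) / Fintype.card A := fun i => by
    rw [hδ]
    gcongr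
    exact hki i
  let h : A × (A → B) → A → B := fun p => overrideInv (e p.1) p.2
  have hsurj : ∀ p, Function.Surjective (h p) := fun p => overrideInv_surjective (he p.1) p.2
  rcases le_total δ 0 with hδ₀ | hδ₀
  · refine ⟨h (Classical.arbitrary _), hsurj _, le_trans ?_ (Nat.cast_nonneg (α := ℚ) _)⟩
    exact mul_nonpos_of_nonpos_of_nonneg (mul_nonpos_of_nonpos_of_nonneg hδ₀ hμ₀)
      (Finset.sum_nonneg fun i _ => Nat.cast_nonneg _)
  obtain ⟨p, hp⟩ := exists_mul_sum_card_le_val RA RB h (δ * μ) fun i t ht => by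
    refine le_trans ?_ (card_filter_overrideInv_ge e he' (hdist i t ht) (RB i))
    exact mul_le_mul_of_nonneg_right (mul_le_mul (hδi i) (hμi i) hμ₀ (hδ₀.trans (hδi i)))
      (Nat.cast_nonneg _)
  exact ⟨h p, hsurj p, hp⟩
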